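/- arXiv:1708.05813 — 4 statements merged into one kernel-verified Lean document; each statement's English description precedes it below -/
import Mathlib

section
/- Let A be a local integral domain containing a field k of characteristic zero. Then every locally finite k-derivation of A is zero. -/
/-- A derivation shifted by scalars satisfies the higher Leibniz rule. -/
theorem Derivation.sub_algebraMap_pow_mul {L S : Type*} [CommRing L] [CommRing S] [Algebra L S]
    (d : Derivation L S S) (r s : L) (n : ℕ) (a b : S) :
    (((d : Module.End L S) - algebraMap L _ (r + s)) ^ n) (a * b) =
      ∑ ij ∈ Finset.HasAntidiagonal.antidiagonal n, n.choose ij.1 •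
        ((((d : Module.End L S) - algebraMap L _ r) ^ ij.1) a *
          (((d : Module.End L S) - algebraMap L _ s) ^ ij.2) b) := by
  induction n with
  | zero => simp
  | succ n ih =>
    rw [Finset.sum_antidiagonal_choose_succ_nsmul
      (fun i j => ((((d : Module.End L S) - algebraMap L _ r) ^ i) a *
          (((d : Module.End L S) - algebraMap L _ s) ^ j) b)), pow_succ', Module.End.mul_apply, ih,
      map_sum, ← Finset.sum_add_distrib]
    refine Finset.sum_congr rfl fun ij hij => ?_
    have hchoose : n.choose ij.2 = n.choose ij.1 :=
      (Nat.choose_symm_of_eq_add (Finset.HasAntidiagonal.mem_antidiagonal.mp hij).symm).symm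
    rw [map_nsmul, hchoose, ← nsmul_add, pow_succ', pow_succ', Module.End.mul_apply,
      Module.End.mul_apply]
    congr 1
    simp [Module.algebraMap_end_apply, Algebra.smul_def]
    ring

/-- Generalized eigenspaces of a derivation multiply into each other. -/
theorem Derivation.mul_mem_maxGenEigenspace {L S : Type*} [CommRing L] [CommRing S] [Algebra L S]
    (d : Derivation L S S) {r s : L} {a b : S}
    (ha : a ∈ Module.End.maxGenEigenspace (d : Module.End L S) r)
    (hb : b ∈ Module.End.maxGenEigenspace (d : Module.End L S) s) :
    a * b ∈ Module.End.maxGenEigenspace (d : Module.End L S) (r + s) := by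
  rw [Module.End.mem_maxGenEigenspace] at *
  simp only [← Algebra.algebraMap_eq_smul_one] at *
  obtain ⟨m, hm⟩ := ha
  obtain ⟨n, hn⟩ := hb
  refine ⟨m + n, ?_⟩
  rw [d.sub_algebraMap_pow_mul]
  refine Finset.sum_eq_zero fun ij hij => ?_
  rw [Finset.HasAntidiagonal.mem_antidiagonal] at hij
  rcases le_or_gt m ij.1 with h | h
  · rw [Module.End.pow_map_zero_of_le h hm, zero_mul, smul_zero]
  · rw [Module.End.pow_map_zero_of_le (by omega : n ≤ ij.2) hn, mul_zero, smul_zero]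

/-- Over a domain of characteristic zero, mutually inverse generalized eigenvectors of a derivation
are eigenvectors. -/
theorem Derivation.apply_eq_smul_of_mul_eq_one {L S : Type*} [CommRing L] [CommRing S] [IsDomain S]
    [CharZero S] [Algebra L S] (d : Derivation L S S) {r s : L} {a b : S} (hrs : r + s = 0)
    (hab : a * b = 1) (ha : a ∈ Module.End.maxGenEigenspace (d : Module.End L S) r)
    (hb : b ∈ Module.End.maxGenEigenspace (d : Module.End L S) s) :
    d a = r • a := by
  classical
  rw [Module.End.mem_maxGenEigenspace] at ha hb
  simp only [← Algebra.algebraMap_eq_smul_one] at ha hb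
  have ha0 : a ≠ 0 := left_ne_zero_of_mul_eq_one hab
  have hb0 : b ≠ 0 := right_ne_zero_of_mul_eq_one hab
  obtain ⟨m, hm⟩ : ∃ m, Nat.find ha = m + 1 := Nat.exists_eq_succ_of_ne_zero fun h =>
    ha0 (by simpa [h] using Nat.find_spec ha)
  obtain ⟨n, hn⟩ : ∃ n, Nat.find hb = n + 1 := Nat.exists_eq_succ_of_ne_zero fun h =>
    hb0 (by simpa [h] using Nat.find_spec hb)
  have ham := hm ▸ Nat.find_spec ha
  have hbn := hn ▸ Nat.find_spec hb
  have ham' := Nat.find_min ha (m := m) (by omega)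
  have hbn' := Nat.find_min hb (m := n) (by omega)
  have key := d.sub_algebraMap_pow_mul r s (m + n) a b
  rw [Finset.sum_eq_single (m, n)] at key
  · have hmn : m + n = 0 := by
      by_contra h
      obtain ⟨l, hl⟩ := Nat.exists_eq_succ_of_ne_zero h
      rw [hrs, hab, hl, pow_succ, Module.End.mul_apply] at key
      simp only [map_zero, sub_zero, Derivation.coeFn_coe, Derivation.map_one_eq_zero] at key
      rw [eq_comm, nsmul_eq_mul] at key
      simp only [mul_eq_zero, Nat.cast_eq_zero, ham', hbn', or_false] at key
      exact (Nat.choose_pos (by omega)).ne' key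
    obtain rfl : m = 0 := by omega
    simpa [sub_eq_zero, Module.algebraMap_end_apply] using ham
  · rintro ⟨i, j⟩ hij hne
    rw [Finset.HasAntidiagonal.mem_antidiagonal] at hij
    simp only at hij ⊢
    rcases lt_or_ge m i with h | h
    · rw [Module.End.pow_map_zero_of_le h ham, zero_mul, smul_zero]
    · have : n + 1 ≤ j := by
        rcases h.lt_or_eq with h | rfl
        · omega
        · exact absurd (by simp; omega) hne
      rw [Module.End.pow_map_zero_of_le this hbn, mul_zero, smul_zero]
  · simp

/-- Two factors of `1` in a group algebra with two unique sums are monomials of opposite degree. -/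
theorem AddMonoidAlgebra.exists_eq_single_of_mul_eq_one {S G : Type*} [CommRing S] [IsDomain S]
    [AddMonoid G] [TwoUniqueSums G] {p q : AddMonoidAlgebra S G} (h : p * q = 1) :
    ∃ (g g' : G) (a b : S), g + g' = 0 ∧ p = single g a ∧ q = single g' b := by
  classical
  have hp : p.coeff.support.Nonempty := by
    rw [Finsupp.support_nonempty_iff, Ne, coeff_eq_zero]
    rintro rfl
    simp at h
  have hq : q.coeff.support.Nonempty := by
    rw [Finsupp.support_nonempty_iff, Ne, coeff_eq_zero]
    rintro rfl
    simp at h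
  have hzero {x y : G} (hx : x ∈ p.coeff.support) (hy : y ∈ q.coeff.support)
      (hu : UniqueAdd p.coeff.support q.coeff.support x y) : x + y = 0 := by
    have := coeff_mul_add_of_uniqueAdd hu
    by_contra hne
    rw [h, one_def, coeff_single, Finsupp.single_eq_of_ne hne, eq_comm, mul_eq_zero] at this
    simp only [Finsupp.mem_support_iff] at hx hy
    tauto
  have hcard : p.coeff.support.card * q.coeff.support.card ≤ 1 := by
    by_contra! hlt
    obtain ⟨x, hx, y, hy, hne, hux, huy⟩ := TwoUniqueSums.uniqueAdd_of_one_lt_card hlt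
    rw [Finset.mem_product] at hx hy
    have := hux hy.1 hy.2 ((hzero hy.1 hy.2 huy).trans (hzero hx.1 hx.2 hux).symm)
    exact hne (Prod.ext this.1.symm this.2.symm)
  have hp1 := hp.card_pos
  have hq1 := hq.card_pos
  obtain ⟨g, a, -, hg⟩ := Finsupp.card_support_eq_one'.mp
    (by nlinarith : p.coeff.support.card = 1)
  obtain ⟨g', b, -, hg'⟩ := Finsupp.card_support_eq_one'.mp
    (by nlinarith : q.coeff.support.card = 1)
  refine ⟨g, g', a, b, ?_, by ext; simp [hg], by ext; simp [hg']⟩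
  refine hzero (by simp_all) (by simp_all) ?_
  intro x y hx hy _
  simp_all

/-- A unit which, together with its inverse, is a sum of generalized eigenvectors of a derivation
is an eigenvector. -/
theorem Derivation.exists_apply_eq_smul_of_mul_eq_one {L S : Type*} [Field L] [CharZero L]
    [CommRing S] [IsDomain S] [Algebra L S] (d : Derivation L S S) {f g : S} (hfg : f * g = 1)
    (hf : f ∈ ⨆ r, Module.End.maxGenEigenspace (d : Module.End L S) r)
    (hg : g ∈ ⨆ r, Module.End.maxGenEigenspace (d : Module.End L S) r) :
    ∃ r : L, d f = r • f := by
  classical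
  have : CharZero S := charZero_of_injective_algebraMap (algebraMap L S).injective
  obtain ⟨p, hp, rfl⟩ := (Submodule.mem_iSup_iff_exists_finsupp _ _).mp hf
  obtain ⟨q, hq, rfl⟩ := (Submodule.mem_iSup_iff_exists_finsupp _ _).mp hg
  set P : AddMonoidAlgebra S L := .ofCoeff p
  set Q : AddMonoidAlgebra S L := .ofCoeff q
  let φ : AddMonoidAlgebra S L →ₐ[S] S := AddMonoidAlgebra.lift S S L 1
  have hφ (x : AddMonoidAlgebra S L) : φ x = x.coeff.sum fun _ y => y := by
    simp [φ, AddMonoidAlgebra.lift_apply]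
  have hmem (r : L) : (P * Q).coeff r ∈ Module.End.maxGenEigenspace (d : Module.End L S) r := by
    rw [AddMonoidAlgebra.coeff_mul]
    refine Submodule.sum_mem _ fun i _ => Submodule.sum_mem _ fun j _ => ?_
    dsimp only
    split_ifs with h
    · exact h ▸ d.mul_mem_maxGenEigenspace (hp i) (hq j)
    · exact Submodule.zero_mem _
  have hone (r : L) : (1 : AddMonoidAlgebra S L).coeff r ∈
      Module.End.maxGenEigenspace (d : Module.End L S) r := by
    rw [AddMonoidAlgebra.one_def, AddMonoidAlgebra.coeff_single, Finsupp.single_apply]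
    split_ifs with h
    · subst h
      rw [Module.End.mem_maxGenEigenspace]
      exact ⟨1, by simp⟩
    · exact Submodule.zero_mem _
  have hPQ : P * Q = 1 := by
    rw [← sub_eq_zero, ← AddMonoidAlgebra.coeff_eq_zero]
    have hind := (iSupIndep_iff_finsetSum_eq_zero_imp_eq_zero _).mp
      (Module.End.independent_maxGenEigenspace (d : Module.End L S))
    have hsum : φ (P * Q - 1) = 0 := by
      rw [map_sub, map_mul, map_one, hφ, hφ, sub_eq_zero]
      exact hfg
    rw [hφ] at hsum
    ext r
    by_cases hr : r ∈ (P * Q - 1).coeff.support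
    · exact hind _ _ (fun i _ => Submodule.sub_mem _ (hmem i) (hone i)) hsum r hr
    · simpa using hr
  obtain ⟨r, s, a, b, hrs, hPa, hQb⟩ := AddMonoidAlgebra.exists_eq_single_of_mul_eq_one hPQ
  obtain rfl : p = Finsupp.single r a := congrArg AddMonoidAlgebra.coeff hPa
  obtain rfl : q = Finsupp.single s b := congrArg AddMonoidAlgebra.coeff hQb
  simp only [Finsupp.sum_single_index] at hfg ⊢
  exact ⟨r, d.apply_eq_smul_of_mul_eq_one hrs hfg (by simpa using hp r) (by simpa using hq s)⟩

/-- A vector whose orbit under an endomorphism lies in a finite-dimensional space is a sum of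
generalized eigenvectors. -/
theorem Module.End.mem_iSup_maxGenEigenspace_of_finiteDimensional {L V : Type*} [Field L]
    [IsAlgClosed L] [AddCommGroup V] [Module L V] (T : Module.End L V) (v : V)
    (W : Submodule L V) [FiniteDimensional L W] (h : ∀ n : ℕ, (T ^ n) v ∈ W) :
    v ∈ ⨆ r, T.maxGenEigenspace r := by
  let U : Submodule L V := Submodule.span L (Set.range fun n : ℕ => (T ^ n) v)
  have hUW : U ≤ W := Submodule.span_le.mpr (by rintro _ ⟨n, rfl⟩; exact h n)
  have : FiniteDimensional L U := Submodule.finiteDimensional_of_le hUW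
  have hT : ∀ x ∈ U, T x ∈ U := by
    intro x hx
    refine Submodule.span_le (p := U.comap T).mpr ?_ hx
    rintro _ ⟨n, rfl⟩
    refine Submodule.subset_span ⟨n + 1, ?_⟩
    simp [pow_succ']
  have hv : v ∈ U := Submodule.subset_span ⟨0, by simp⟩
  have htop := Module.End.iSup_maxGenEigenspace_eq_top (T.restrict hT)
  have hmem : v ∈ (⨆ r, maxGenEigenspace (T.restrict hT) r).map U.subtype := by
    rw [htop]
    exact ⟨⟨v, hv⟩, trivial, rfl⟩
  rw [Submodule.map_iSup] at hmem
  suffices hle : ∀ r,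
      (maxGenEigenspace (T.restrict hT) r).map U.subtype ≤ T.maxGenEigenspace r from
    (iSup_mono hle : _ ≤ _) hmem
  intro r
  rw [maxGenEigenspace, genEigenspace_restrict]
  exact Submodule.map_comap_le _ _

section TaylorSeries

open PowerSeries

/-- The formal flow `∑ Dⁿ(a) tⁿ / n!` of a derivation, with coefficients in an extension field. -/
noncomputable def Derivation.taylorSeries {k A : Type*} [CommRing k] [CommRing A] [Algebra k A]
    (D : Derivation k A A) (L : Type*) [Field L] [Algebra A L] (a : A) : L⟦X⟧ :=
  PowerSeries.mk fun n => algebraMap A L (D^[n] a) / (n.factorial : L)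

variable {k A L : Type*} [CommRing k] [CommRing A] [Algebra k A] (D : Derivation k A A)
  [Field L] [CharZero L] [Algebra A L]

theorem Derivation.derivative_taylorSeries (a : A) :
    d⁄dX L (D.taylorSeries L a) = D.taylorSeries L (D a) := by
  ext n
  have h : ((n : L) + 1) ≠ 0 := by exact_mod_cast n.succ_ne_zero
  have h' : (n.factorial : L) ≠ 0 := by exact_mod_cast n.factorial_ne_zero
  simp only [coeff_derivative, taylorSeries, coeff_mk, Nat.factorial_succ, Nat.cast_mul,
    Nat.cast_succ, Function.iterate_succ_apply]
  field_simp

theorem Derivation.taylorSeries_mul (a b : A) :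
    D.taylorSeries L (a * b) = D.taylorSeries L a * D.taylorSeries L b := by
  ext n
  induction n generalizing a b with
  | zero => simp [taylorSeries, coeff_mul]
  | succ n ih =>
    have h : ((n : L) + 1) ≠ 0 := by exact_mod_cast n.succ_ne_zero
    apply mul_right_cancel₀ h
    rw [← coeff_derivative, ← coeff_derivative, D.derivative_taylorSeries, Derivation.leibniz,
      Derivation.leibniz, D.derivative_taylorSeries, D.derivative_taylorSeries]
    have hadd (x y : A) : D.taylorSeries L (x + y) = D.taylorSeries L x + D.taylorSeries L y := by
      ext m
      simp [taylorSeries, iterate_map_add, add_div]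
    simp only [hadd, map_add, smul_eq_mul, ih]

end TaylorSeries

open PowerSeries in
/-- At an element with finite-dimensional orbit, the Taylor series is a sum of generalized
eigenvectors of the formal derivative. -/
theorem Derivation.taylorSeries_mem_iSup_maxGenEigenspace {k A L : Type*} [CommRing k] [CommRing A]
    [Algebra k A] (D : Derivation k A A) [Field L] [CharZero L] [IsAlgClosed L] [Algebra A L]
    {a : A} (ha : (Submodule.span k (Set.range fun m : ℕ => (⇑D)^[m] a)).FG) :
    D.taylorSeries L a ∈ ⨆ r, Module.End.maxGenEigenspace (d⁄dX L : Module.End L L⟦X⟧) r := by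
  classical
  obtain ⟨T, hT⟩ := ha
  let W : Submodule L L⟦X⟧ := Submodule.span L (T.image (D.taylorSeries L) : Finset L⟦X⟧)
  have hW {x : A} (hx : x ∈ Submodule.span k (T : Set A)) : D.taylorSeries L x ∈ W := by
    induction hx using Submodule.span_induction with
    | mem x hx => exact Submodule.subset_span (by simpa using ⟨x, hx, rfl⟩)
    | zero =>
      convert W.zero_mem
      ext n
      simp [taylorSeries, iterate_map_zero]
    | add x y _ _ hx hy =>
      convert W.add_mem hx hy
      ext n
      simp [taylorSeries, iterate_map_add, add_div]
    | smul c x _ hx =>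
      convert W.smul_mem (algebraMap A L (algebraMap k A c)) hx
      ext n
      have hn : D^[n] (c • x) = c • D^[n] x :=
        (Function.Commute.iterate_left (f := D) (g := fun y => c • y) (D.map_smul c) n) x
      simp only [taylorSeries, coeff_mk, hn]
      rw [PowerSeries.coeff_smul, coeff_mk, smul_eq_mul, Algebra.smul_def, map_mul, mul_div_assoc]
  refine Module.End.mem_iSup_maxGenEigenspace_of_finiteDimensional _ _ W fun n => ?_
  have hiter : ((d⁄dX L : Module.End L L⟦X⟧) ^ n) (D.taylorSeries L a) =
      D.taylorSeries L (D^[n] a) := by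
    induction n with
    | zero => simp
    | succ n ih =>
      rw [pow_succ', Module.End.mul_apply, ih, Function.iterate_succ_apply']
      exact D.derivative_taylorSeries _
  rw [hiter]
  exact hW (hT ▸ Submodule.subset_span ⟨n, rfl⟩)

open PowerSeries in
/-- If a derivation is locally finite at a unit and at its inverse, then the unit and its derivative
are eigenvectors with a common eigenvalue in any algebraically closed extension. -/
theorem Derivation.exists_eigenvalue_of_mul_eq_one {k A : Type*} (L : Type*) [CommRing k]
    [CommRing A] [Algebra k A] (D : Derivation k A A) [Field L] [CharZero L] [IsAlgClosed L]
    [Algebra A L] {u v : A} (huv : u * v = 1)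
    (hu : (Submodule.span k (Set.range fun m : ℕ => (⇑D)^[m] u)).FG)
    (hv : (Submodule.span k (Set.range fun m : ℕ => (⇑D)^[m] v)).FG) :
    ∃ r : L, algebraMap A L (D u) = r * algebraMap A L u ∧
      algebraMap A L (D (D u)) = r * algebraMap A L (D u) := by
  have hone : D.taylorSeries L u * D.taylorSeries L v = 1 := by
    rw [← D.taylorSeries_mul, huv]
    ext n
    rcases n with _ | n
    · simp [taylorSeries]
    · simp [taylorSeries, coeff_one, iterate_map_zero]
  obtain ⟨r, hr⟩ := (d⁄dX L).exists_apply_eq_smul_of_mul_eq_one hone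
    (D.taylorSeries_mem_iSup_maxGenEigenspace hu) (D.taylorSeries_mem_iSup_maxGenEigenspace hv)
  rw [D.derivative_taylorSeries] at hr
  refine ⟨r, ?_, ?_⟩
  · simpa [taylorSeries] using congrArg (coeff 0) hr
  · simpa [taylorSeries] using congrArg (coeff 1) hr

theorem stmt10 (k : Type*) [Field k] [CharZero k] (A : Type*) [CommRing A] [IsDomain A]
    [IsLocalRing A] [Algebra k A] (D : Derivation k A A)
    (hlf : ∀ a : A, (Submodule.span k (Set.range fun m : ℕ => (⇑D)^[m] a)).FG) :
    D = 0 := by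
  let L := AlgebraicClosure (FractionRing A)
  have : CharZero A := charZero_of_injective_algebraMap (algebraMap k A).injective
  have hinj : Function.Injective (algebraMap A L) := by
    rw [IsScalarTower.algebraMap_eq A (FractionRing A) L]
    exact (algebraMap (FractionRing A) L).injective.comp (IsFractionRing.injective A _)
  have : CharZero L := charZero_of_injective_algebraMap hinj
  have heigen {u : A} (hu : IsUnit u) : ∃ r : L, algebraMap A L (D u) = r * algebraMap A L u ∧
      algebraMap A L (D (D u)) = r * algebraMap A L (D u) := by
    obtain ⟨v, hv⟩ := hu.exists_right_inv
    exact D.exists_eigenvalue_of_mul_eq_one L hv (hlf u) (hlf v)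
  have hunit {u : A} (hu : IsUnit u) : D u = 0 := by
    obtain ⟨c, hc, hDc, huc⟩ : ∃ c : A, c ≠ 0 ∧ D c = 0 ∧ IsUnit (u + c) := by
      have h2 : IsUnit ((u + 1) + -(u + -1)) := by
        have : (u + 1) + -(u + -1) = algebraMap k A 2 := by rw [map_ofNat]; ring
        rw [this]
        exact (IsUnit.mk0 (2 : k) two_ne_zero).map _
      rcases IsLocalRing.isUnit_or_isUnit_of_isUnit_add h2 with h | h
      · exact ⟨1, one_ne_zero, D.map_one_eq_zero, h⟩
      · exact ⟨-1, by simp, by simp, by simpa using h.neg⟩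
    obtain ⟨r, hr, hr'⟩ := heigen hu
    obtain ⟨s, hs, hs'⟩ := heigen huc
    rw [map_add, hDc, add_zero] at hs hs'
    by_contra hne
    have hne' : algebraMap A L (D u) ≠ 0 := (map_ne_zero_iff _ hinj).mpr hne
    obtain rfl : r = s := mul_right_cancel₀ hne' (hr'.symm.trans hs')
    have hrc : r * algebraMap A L c = 0 := by
      rw [map_add] at hs
      linear_combination hr - hs
    rcases mul_eq_zero.mp hrc with h | h
    · exact hne' (by rw [hr, h, zero_mul])
    · exact hc ((map_eq_zero_iff _ hinj).mp h)
  ext a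
  rcases IsLocalRing.isUnit_or_isUnit_one_sub_self a with h | h
  · exact hunit h
  · simpa using hunit h
end

section
/- Every locally finite k-algebra endomorphism φ of the formal power series ring k[[x_1,…,x_n]] over a field k of characteristic zero satisfies φ^i = φ^j for some 1 ≤ i < j; hence the image of 1 − φ is a Mathieu–Zhao space of k[[x_1,…,x_n]]. -/
open Polynomial

/-- **Baire category theorem** for a countable power of a discrete space: if `ι → α` is a countable
union of sets whose complements are determined locally by finitely many coordinates, then one of
the sets contains a cylinder. -/
theorem exists_cylinder_subset_of_iUnion_eq_univ {ι α : Type*} [Countable ι] [Nonempty α]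
    (W : ℕ → Set (ι → α))
    (hW : ∀ d, ∀ f ∉ W d, ∃ S : Finset ι, ∀ g, (∀ s ∈ S, g s = f s) → g ∉ W d)
    (hU : ⋃ d, W d = Set.univ) :
    ∃ d, ∃ f : ι → α, ∃ S : Finset ι, ∀ g, (∀ s ∈ S, g s = f s) → g ∈ W d := by
  let _ : UniformSpace α := ⊥
  have : DiscreteTopology α := ⟨rfl⟩
  have hclosed : ∀ d, IsClosed (W d) := fun d => by
    rw [← isOpen_compl_iff, isOpen_pi_iff]
    intro f hf
    obtain ⟨S, hS⟩ := hW d f hf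
    exact ⟨S, fun s => {f s}, fun s _ => ⟨isOpen_discrete _, rfl⟩, fun g hg => hS g hg⟩
  obtain ⟨d, f, hf⟩ := nonempty_interior_of_iUnion_of_closed hclosed hU
  obtain ⟨S, u, hu, hsub⟩ := isOpen_pi_iff.1 isOpen_interior f hf
  refine ⟨d, f, S, fun g hg => interior_subset (hsub fun s hs => ?_)⟩
  rw [hg s hs]
  exact (hu s hs).2

section LinearMap

variable {k V : Type*} [Field k] [AddCommGroup V] [Module k V] {T : Module.End k V}

theorem Module.End.aeval_apply_eq_zero_of_dvd {p q : k[X]} {v : V} (hpq : p ∣ q)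
    (hp : aeval T p v = 0) : aeval T q v = 0 := by
  obtain ⟨s, rfl⟩ := hpq
  rw [mul_comm, map_mul, Module.End.mul_apply, hp, map_zero]

variable (T) in
/-- If every vector is killed by a nonzero polynomial in `T` of bounded degree, then so is the whole
space. -/
theorem Module.End.exists_aeval_eq_zero_of_bounded [Infinite k] (D : ℕ)
    (h : ∀ v, ∃ p : k[X], p ≠ 0 ∧ p.natDegree ≤ D ∧ aeval T p v = 0) :
    ∃ p : k[X], p ≠ 0 ∧ aeval T p = 0 := by
  classical
  have hex : ∃ D, ∀ v, ∃ p : k[X], p ≠ 0 ∧ p.natDegree ≤ D ∧ aeval T p v = 0 := ⟨D, h⟩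
  set d := Nat.find hex with hd
  have hann := Nat.find_spec hex
  rw [← hd] at hann
  obtain ⟨v, hv⟩ : ∃ v, ∀ p : k[X], p ≠ 0 → p.natDegree < d → aeval T p v ≠ 0 := by
    by_contra! hcon
    obtain ⟨p, hp, hpd, -⟩ := hcon 0
    refine Nat.find_min hex (m := d - 1) (by lia) fun v => ?_
    obtain ⟨q, hq, hqd, hqv⟩ := hcon v
    exact ⟨q, hq, by lia, hqv⟩
  obtain ⟨p, hp, -, hpv⟩ := hann v
  refine ⟨p, hp, LinearMap.ext fun w => ?_⟩
  obtain ⟨q, hq, -, hqw⟩ := hann w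
  have hL : p * q ≠ 0 := mul_ne_zero hp hq
  have hline : ∀ c : k, ∃ r : k[X], r ≠ 0 ∧ r ∣ p * q ∧ r.natDegree ≤ d ∧
      aeval T r (v + c • w) = 0 := by
    intro c
    obtain ⟨r, hr, hrd, hrv⟩ := hann (v + c • w)
    refine ⟨EuclideanDomain.gcd r (p * q), ?_, EuclideanDomain.gcd_dvd_right _ _,
      (natDegree_le_of_dvd (EuclideanDomain.gcd_dvd_left _ _) hr).trans hrd, ?_⟩
    · exact fun h0 => hr (EuclideanDomain.gcd_eq_zero_iff.1 h0).1
    · have hLv : aeval T (p * q) (v + c • w) = 0 := by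
        rw [map_add, map_smul, aeval_apply_eq_zero_of_dvd (dvd_mul_right p q) hpv,
          aeval_apply_eq_zero_of_dvd (dvd_mul_left q p) hqw,
          smul_zero, add_zero]
      rw [EuclideanDomain.gcd_eq_gcd_ab, map_add (aeval T), LinearMap.add_apply,
        aeval_apply_eq_zero_of_dvd (dvd_mul_right _ _) hrv,
          aeval_apply_eq_zero_of_dvd (dvd_mul_right _ _) hLv, add_zero]
  choose r hr hrL hrd hrv using hline
  obtain ⟨a, -, b, -, hab, heq⟩ := Set.infinite_univ.exists_ne_map_eq_of_mapsTo
    (f := fun c => UniqueFactorizationMonoid.normalizedFactors (r c))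
    (t := ((UniqueFactorizationMonoid.normalizedFactors (p * q)).powerset.toFinset : Set _))
    (fun c _ => by
      simpa using (UniqueFactorizationMonoid.dvd_iff_normalizedFactors_le_normalizedFactors
        (hr c) hL).1 (hrL c)) (Finset.finite_toSet _)
  have hassoc : r b ∣ r a :=
    ((UniqueFactorizationMonoid.associated_iff_normalizedFactors_eq_normalizedFactors
      (hr a) (hr b)).2 heq).symm.dvd
  have ha := hrv a
  have hb := aeval_apply_eq_zero_of_dvd hassoc (hrv b)
  rw [map_add, map_smul] at ha hb
  have hw : aeval T (r a) w = 0 := by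
    have : (a - b) • aeval T (r a) w = 0 := by
      rw [sub_smul, sub_eq_zero]
      exact add_left_cancel (ha.trans hb.symm)
    exact (smul_eq_zero.1 this).resolve_left (sub_ne_zero.2 hab)
  have hv0 : aeval T (r a) v = 0 := by rwa [hw, smul_zero, add_zero] at ha
  have hmod : aeval T (p % r a) v = 0 := by
    rw [EuclideanDomain.mod_eq_sub_mul_div, map_sub, LinearMap.sub_apply, hpv,
      aeval_apply_eq_zero_of_dvd (dvd_mul_right _ _) hv0, sub_zero]
  refine aeval_apply_eq_zero_of_dvd (EuclideanDomain.mod_eq_zero.1 ?_) hw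
  by_contra hne
  refine hv _ hne (lt_of_lt_of_le ?_ (hrd a)) hmod
  exact natDegree_lt_natDegree hne (degree_mod_lt p (hr a))

theorem Module.End.aeval_apply_mem {F : Submodule k V} (hF : ∀ v ∈ F, T v ∈ F) (p : k[X]) {v : V}
    (hv : v ∈ F) : aeval T p v ∈ F := by
  induction p using Polynomial.induction_on generalizing v with
  | C a => simpa using F.smul_mem a hv
  | add p q hp hq => simpa using F.add_mem (hp hv) (hq hv)
  | monomial n a h =>
    rw [pow_succ, ← mul_assoc, map_mul, aeval_X, Module.End.mul_apply]
    exact h (hF v hv)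

/-- For a separated `T`-stable filtration `F`, having no nonzero annihilating polynomial of degree
at most `d` is an open condition on vectors. -/
theorem Module.End.exists_forall_sub_mem_aeval_ne_zero {F : ℕ → Submodule k V} (hanti : Antitone F)
    (hsep : ∀ v, (∀ r, v ∈ F r) → v = 0) (hF : ∀ r, ∀ v ∈ F r, T v ∈ F r) (d : ℕ) (v : V)
    (hv : ∀ p : k[X], p ≠ 0 → p.natDegree ≤ d → aeval T p v ≠ 0) :
    ∃ r, ∀ w, w - v ∈ F r → ∀ p : k[X], p ≠ 0 → p.natDegree ≤ d → aeval T p w ≠ 0 := by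
  let ev : degreeLT k (d + 1) →ₗ[k] V :=
    (LinearMap.applyₗ v).comp ((aeval T).toLinearMap.comp (degreeLT k (d + 1)).subtype)
  let K : ℕ → Submodule k (degreeLT k (d + 1)) := fun r => (F r).comap ev
  have : FiniteDimensional k (degreeLT k (d + 1)) :=
    (degreeLTEquiv k (d + 1)).symm.finiteDimensional
  have hK : Antitone K := fun r s hrs => Submodule.comap_mono (hanti hrs)
  obtain ⟨r, hr⟩ := IsArtinian.monotone_stabilizes (R := k) (M := degreeLT k (d + 1))
    ⟨fun r => OrderDual.toDual (K r), fun r s hrs => hK hrs⟩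
  refine ⟨r, fun w hw p hp hpd hpw => ?_⟩
  have hpmem : p ∈ degreeLT k (d + 1) := by
    rw [mem_degreeLT]
    exact (degree_le_natDegree).trans_lt (by exact_mod_cast Nat.lt_succ_of_le hpd)
  have hpr : aeval T p v ∈ F r := by
    have := aeval_apply_mem (hF r) p hw
    rw [map_sub, hpw, zero_sub] at this
    simpa using (F r).neg_mem this
  refine hv p hp hpd (hsep _ fun s => ?_)
  rcases le_total r s with hrs | hsr
  · have hEq : K r = K s := hr s hrs
    have : (⟨p, hpmem⟩ : degreeLT k (d + 1)) ∈ K r := hpr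
    rw [hEq] at this
    exact this
  · exact hanti hsr hpr

theorem Module.End.exists_aeval_apply_eq_zero (v : V)
    (h : (Submodule.span k (Set.range fun m : ℕ => (T ^ (m + 1)) v)).FG) :
    ∃ p : k[X], p ≠ 0 ∧ aeval T p v = 0 := by
  set S := Submodule.span k (Set.range fun m : ℕ => (T ^ (m + 1)) v)
  have : FiniteDimensional k S := Module.Finite.iff_fg.2 h
  let ev : k[X] →ₗ[k] V := (LinearMap.applyₗ v).comp
    ((aeval T).toLinearMap.comp (LinearMap.mulLeft k (X : k[X])))
  have hev : ∀ p, ev p = aeval T (X * p) v := fun p => rfl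
  have hmem : ∀ p, ev p ∈ S := fun p => by
    induction p using Polynomial.induction_on' with
    | add p q hp hq => rw [map_add]; exact S.add_mem hp hq
    | monomial n a =>
      have : ev (monomial n a) = a • (T ^ (n + 1)) v := by
        rw [hev, X_mul_monomial, aeval_monomial]
        simp
      rw [this]
      exact S.smul_mem a (Submodule.subset_span ⟨n, rfl⟩)
  have hni : ¬ Function.Injective (ev.codRestrict S hmem) := fun hinj =>
    Polynomial.not_finite (R := k) (Module.Finite.of_injective _ hinj)
  rw [← LinearMap.ker_eq_bot, Submodule.eq_bot_iff] at hni
  push Not at hni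
  obtain ⟨p, hp, hp0⟩ := hni
  exact ⟨X * p, mul_ne_zero X_ne_zero hp0, congrArg Subtype.val hp⟩

end LinearMap

namespace MvPowerSeries

variable {σ k : Type*} [Field k]

variable (σ k) in
/-- The subspace of power series of order at least `r`. -/
def orderGE (r : ℕ) : Submodule k (MvPowerSeries σ k) where
  carrier := {f | (r : ℕ∞) ≤ f.order}
  add_mem' hf hg := (le_min hf hg).trans min_order_le_add
  zero_mem' := by simp
  smul_mem' _ _ hf := le_trans hf le_order_smul

theorem mem_orderGE {r : ℕ} {f : MvPowerSeries σ k} : f ∈ orderGE σ k r ↔ (r : ℕ∞) ≤ f.order :=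
  Iff.rfl

theorem mem_orderGE_iff_coeff {r : ℕ} {f : MvPowerSeries σ k} :
    f ∈ orderGE σ k r ↔ ∀ e, e.degree < r → coeff e f = 0 :=
  ⟨fun h _ he => coeff_of_lt_order ((Nat.cast_lt.2 he).trans_le h), fun h => nat_le_order h⟩

theorem antitone_orderGE : Antitone (orderGE σ k) :=
  fun _ _ hrs _ hf => le_trans (Nat.cast_le.2 hrs) (mem_orderGE.1 hf)

theorem eq_zero_of_forall_mem_orderGE {f : MvPowerSeries σ k} (h : ∀ r, f ∈ orderGE σ k r) :
    f = 0 := by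
  ext e
  exact mem_orderGE_iff_coeff.1 (h (e.degree + 1)) e (Nat.lt_succ_self _)

/-- A power series of order at least `r + 1` is a combination of the variables with coefficients of
order at least `r`. -/
theorem exists_sum_X_mul_eq_of_mem_orderGE [Fintype σ] {r : ℕ} {f : MvPowerSeries σ k}
    (hf : f ∈ orderGE σ k (r + 1)) :
    ∃ g : σ → MvPowerSeries σ k, (∀ i, g i ∈ orderGE σ k r) ∧ ∑ i, X i * g i = f := by
  classical
  have hpick : ∀ e : σ →₀ ℕ, ∃ o : Option σ,
      e ≠ 0 → ∃ i, o = some i ∧ Finsupp.single i 1 ≤ e := by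
    intro e
    by_cases he : e = 0
    · exact ⟨none, fun h => absurd he h⟩
    · obtain ⟨i, hi⟩ := Finsupp.ne_iff.1 he
      refine ⟨some i, fun _ => ⟨i, rfl, ?_⟩⟩
      rw [Finsupp.single_le_iff]
      exact Nat.one_le_iff_ne_zero.2 hi
  choose o ho using hpick
  let g : σ → MvPowerSeries σ k := fun i e =>
    if o (e + Finsupp.single i 1) = some i then coeff (e + Finsupp.single i 1) f else 0
  have hg : ∀ i e, coeff e (g i) =
      if o (e + Finsupp.single i 1) = some i then coeff (e + Finsupp.single i 1) f else 0 :=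
    fun _ _ => rfl
  refine ⟨g, fun i => mem_orderGE_iff_coeff.2 fun e he => ?_, ?_⟩
  · rw [hg]
    split_ifs
    · refine mem_orderGE_iff_coeff.1 hf _ ?_
      simpa using he
    · rfl
  · ext e
    rw [map_sum]
    by_cases he : e = 0
    · subst he
      rw [mem_orderGE_iff_coeff.1 hf 0 (by simp)]
      exact Finset.sum_eq_zero fun i _ => coeff_zero_X_mul _ _
    · obtain ⟨i, hi, hle⟩ := ho e he
      rw [Finset.sum_eq_single i]
      · rw [X, coeff_monomial_mul, if_pos hle, hg, tsub_add_cancel_of_le hle, if_pos hi,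
          one_mul]
      · intro j _ hj
        rw [X, coeff_monomial_mul]
        split_ifs with hjle
        · rw [hg, tsub_add_cancel_of_le hjle, if_neg, mul_zero]
          rw [hi]
          exact fun h => hj (Option.some_injective _ h).symm
        · rfl
      · simp

theorem constantCoeff_algHom_apply_eq_zero (φ : MvPowerSeries σ k →ₐ[k] MvPowerSeries σ k)
    {f : MvPowerSeries σ k} (hf : constantCoeff f = 0) : constantCoeff (φ f) = 0 := by
  by_contra hc
  have hunit : IsUnit (f - algebraMap k _ (constantCoeff (φ f))) := by
    rw [isUnit_iff_constantCoeff, map_sub, hf]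
    simpa [algebraMap_apply] using hc
  have := hunit.map φ
  rw [isUnit_iff_constantCoeff, map_sub, map_sub, AlgHom.commutes] at this
  simp [algebraMap_apply] at this

/-- Every algebra endomorphism of a power series ring in finitely many variables over a field is
continuous. -/
theorem algHom_apply_mem_orderGE [Fintype σ] (φ : MvPowerSeries σ k →ₐ[k] MvPowerSeries σ k)
    (r : ℕ) :
    ∀ f ∈ orderGE σ k r, φ f ∈ orderGE σ k r := by
  induction r with
  | zero => simp [mem_orderGE]
  | succ r ih =>
    intro f hf
    obtain ⟨g, hg, rfl⟩ := exists_sum_X_mul_eq_of_mem_orderGE hf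
    rw [map_sum]
    refine Submodule.sum_mem _ fun i _ => ?_
    rw [map_mul, mem_orderGE]
    refine le_trans ?_ le_order_mul
    rw [Nat.cast_add, add_comm]
    refine add_le_add ?_ (ih _ (hg i))
    rw [Nat.cast_one, one_le_order_iff_constCoeff_eq_zero]
    exact constantCoeff_algHom_apply_eq_zero φ (constantCoeff_X i)

/-- The Baire category theorem for the topology of coefficientwise convergence. -/
theorem exists_forall_coeff_eq_mem_of_iUnion_eq_univ [Finite σ] (W : ℕ → Set (MvPowerSeries σ k))
    (hW : ∀ d, ∀ f ∉ W d, ∃ S : Finset (σ →₀ ℕ), ∀ g, (∀ e ∈ S, coeff e g = coeff e f) → g ∉ W d)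
    (hU : ⋃ d, W d = Set.univ) :
    ∃ d, ∃ f : MvPowerSeries σ k, ∃ S : Finset (σ →₀ ℕ),
      ∀ g, (∀ e ∈ S, coeff e g = coeff e f) → g ∈ W d :=
  exists_cylinder_subset_of_iUnion_eq_univ W hW hU

/-- A locally algebraic algebra endomorphism of a power series ring is algebraic. -/
theorem exists_aeval_toLinearMap_eq_zero [Fintype σ] [Infinite k]
    (φ : MvPowerSeries σ k →ₐ[k] MvPowerSeries σ k)
    (h : ∀ f, ∃ p : k[X], p ≠ 0 ∧ Polynomial.aeval φ.toLinearMap p f = 0) :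
    ∃ p : k[X], p ≠ 0 ∧ Polynomial.aeval φ.toLinearMap p = 0 := by
  classical
  obtain ⟨d, f, S, hS⟩ := exists_forall_coeff_eq_mem_of_iUnion_eq_univ
    (fun d : ℕ => {f : MvPowerSeries σ k | ∃ p : k[X], p ≠ 0 ∧ p.natDegree ≤ d ∧
      Polynomial.aeval φ.toLinearMap p f = 0}) (fun d f hf => by
      obtain ⟨r, hr⟩ := Module.End.exists_forall_sub_mem_aeval_ne_zero antitone_orderGE
        (fun _ => eq_zero_of_forall_mem_orderGE) (algHom_apply_mem_orderGE φ) d f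
        (fun p hp hpd hpf => hf ⟨p, hp, hpd, hpf⟩)
      refine ⟨(Finsupp.finite_of_degree_lt r).toFinset, ?_⟩
      rintro g hg ⟨p, hp, hpd, hpg⟩
      refine hr g (mem_orderGE_iff_coeff.2 fun e he => ?_) p hp hpd hpg
      rw [map_sub, sub_eq_zero]
      exact hg e (by simpa using he))
    (Set.eq_univ_of_forall fun f => by
      obtain ⟨p, hp, hpf⟩ := h f
      exact Set.mem_iUnion.2 ⟨p.natDegree, p, hp, le_rfl, hpf⟩)
  choose a ha ha0 using fun e : σ →₀ ℕ => h (monomial e 1)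
  obtain ⟨q, hq, hqd, hqf⟩ := hS f fun _ _ => rfl
  refine Module.End.exists_aeval_eq_zero_of_bounded _ ((∏ e ∈ S, a e).natDegree + (d + d))
    fun g => ?_
  let t : MvPowerSeries σ k := ∑ e ∈ S, coeff e g • monomial e 1
  have ht : Polynomial.aeval φ.toLinearMap (∏ e ∈ S, a e) t = 0 := by
    rw [map_sum]
    refine Finset.sum_eq_zero fun e he => ?_
    rw [map_smul, Module.End.aeval_apply_eq_zero_of_dvd (Finset.dvd_prod_of_mem a he) (ha0 e),
      smul_zero]
  obtain ⟨p, hp, hpd, hpf⟩ := hS (f + (g - t)) fun e he => by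
    rw [map_add, map_sub, map_sum, Finset.sum_eq_single e]
    · simp
    · intro b _ hb
      simp [coeff_monomial, hb.symm]
    · exact fun h => absurd he h
  refine ⟨(∏ e ∈ S, a e) * (p * q), mul_ne_zero (Finset.prod_ne_zero_iff.2 fun e _ => ha e)
    (mul_ne_zero hp hq), ?_, ?_⟩
  · exact natDegree_mul_le.trans (add_le_add_right
      (natDegree_mul_le.trans (add_le_add hpd hqd)) _)
  · have hg : g = t + (f + (g - t)) - f := by abel
    rw [hg, map_sub, map_add, Module.End.aeval_apply_eq_zero_of_dvd (dvd_mul_right _ _) ht,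
      Module.End.aeval_apply_eq_zero_of_dvd ((dvd_mul_right p q).mul_left _) hpf,
      Module.End.aeval_apply_eq_zero_of_dvd ((dvd_mul_left q p).mul_left _) hqf]
    simp

end MvPowerSeries

theorem AlgHom.toLinearMap_pow_apply {k A : Type*} [CommSemiring k] [Semiring A] [Algebra k A]
    (φ : A →ₐ[k] A) (m : ℕ) (f : A) : (φ.toLinearMap ^ m) f = (φ ^ m) f := by
  rw [Module.End.pow_apply, AlgHom.coe_pow]
  rfl

/-- By Dedekind's independence of characters, an algebraic endomorphism of a domain has only
finitely many distinct powers. -/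
theorem AlgHom.exists_pow_eq_pow_of_aeval_eq_zero {k A : Type*} [Field k] [CommRing A] [IsDomain A]
    [Algebra k A] (φ : A →ₐ[k] A) {p : k[X]} (hp : p ≠ 0) (h : aeval φ.toLinearMap p = 0) :
    ∃ i j : ℕ, 1 ≤ i ∧ i < j ∧ φ ^ i = φ ^ j := by
  by_contra! hcon
  have hinj : Function.Injective fun m : ℕ => ((φ ^ (m + 1) : A →ₐ[k] A) : A →* A) := by
    intro i j hij
    have hij' : φ ^ (i + 1) = φ ^ (j + 1) := AlgHom.ext fun x => DFunLike.congr_fun hij x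
    rcases lt_trichotomy i j with hlt | heq | hlt
    · exact absurd hij' (hcon _ _ (by lia) (by lia))
    · exact heq
    · exact absurd hij'.symm (hcon _ _ (by lia) (by lia))
  have hli := (linearIndependent_monoidHom A A).comp _ hinj
  rw [linearIndependent_iff'] at hli
  refine hp (Polynomial.ext fun m => ?_)
  rw [coeff_zero]
  by_cases hm : m ∈ Finset.range (p.natDegree + 1)
  · have := hli _ (fun m => algebraMap k A (p.coeff m)) (funext fun x => ?_) m hm
    · simpa using this
    · have hx : aeval φ.toLinearMap p (φ x) = 0 := by rw [h]; rfl
      rw [aeval_eq_sum_range, LinearMap.sum_apply] at hx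
      simpa [Algebra.smul_def, pow_succ, AlgHom.toLinearMap_pow_apply] using hx
  · exact coeff_eq_zero_of_natDegree_lt (by simpa using hm)

/-- If all large power sums of finitely many elements of a domain of characteristic zero vanish, then
so do the elements. -/
theorem eq_zero_of_forall_sum_pow_eq_zero {A ι : Type*} [CommRing A] [IsDomain A] [CharZero A]
    (s : Finset ι) (u : ι → A) (N : ℕ) (h : ∀ m ≥ N, ∑ i ∈ s, u i ^ m = 0) :
    ∀ i ∈ s, u i = 0 := by
  classical
  intro i hi
  have hinj : Function.Injective fun a : A => (powersHom A a : Multiplicative ℕ →* A) :=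
    (powersHom A).injective
  have hli := (linearIndependent_monoidHom (Multiplicative ℕ) A).comp _ hinj
  rw [linearIndependent_iff'] at hli
  have := hli (s.image u) (fun a => ((s.filter fun j => u j = a).card : A) * a ^ N)
    (funext fun m => ?_) (u i) (Finset.mem_image_of_mem u hi)
  · refine eq_zero_of_pow_eq_zero (n := N) ((mul_eq_zero.1 this).resolve_left ?_)
    rw [Nat.cast_eq_zero, Finset.card_eq_zero, ← ne_eq, ← Finset.nonempty_iff_ne_empty]
    exact ⟨i, by simp [hi]⟩
  · have hsum := h (N + m.toAdd) (Nat.le_add_right _ _)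
    rw [← Finset.sum_fiberwise_of_maps_to (t := s.image u) (g := u)
      fun j hj => Finset.mem_image_of_mem u hj] at hsum
    simp only [Finset.sum_apply, Pi.smul_apply, Function.comp_apply, Pi.zero_apply, smul_eq_mul]
    rw [← hsum]
    refine Finset.sum_congr rfl fun a _ => ?_
    rw [Finset.sum_congr rfl fun j hj => by rw [(Finset.mem_filter.1 hj).2], Finset.sum_const,
      nsmul_eq_mul, pow_add, mul_assoc]
    rfl

/-- If `T ^ i = T ^ (i + d)` then the image of `1 - T` is the kernel of the trace
`∑ s < d, T ^ (i + s)`. -/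
theorem Module.End.mem_range_sub_iff {k V : Type*} [Field k] [CharZero k] [AddCommGroup V]
    [Module k V] (T : Module.End k V) {i d : ℕ} (hd : d ≠ 0) (h : T ^ i = T ^ (i + d)) (v : V) :
    v ∈ Set.range (fun w => w - T w) ↔ ∑ s ∈ Finset.range d, (T ^ (i + s)) v = 0 := by
  constructor
  · rintro ⟨w, rfl⟩
    have : ∀ s, (T ^ (i + s)) (w - T w) = (T ^ (i + s)) w - (T ^ (i + (s + 1))) w := fun s => by
      rw [map_sub, ← add_assoc, pow_succ, Module.End.mul_apply]
    simp only [this]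
    rw [Finset.sum_range_sub' (fun s => (T ^ (i + s)) w), ← h, add_zero, sub_self]
  · intro hv
    have hpow : ∀ m, ∃ w, v - (T ^ m) v = w - T w := fun m => by
      induction m with
      | zero => exact ⟨0, by simp⟩
      | succ m ih =>
        obtain ⟨w, hw⟩ := ih
        refine ⟨w + (T ^ m) v, ?_⟩
        rw [pow_succ', Module.End.mul_apply, map_add, ← sub_add_sub_cancel v ((T ^ m) v), hw]
        abel
    choose w hw using hpow
    have hd' : (d : k) ≠ 0 := Nat.cast_ne_zero.2 hd
    refine ⟨(d : k)⁻¹ • ∑ s ∈ Finset.range d, w (i + s), ?_⟩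
    have hsum : ∑ s ∈ Finset.range d, (v - (T ^ (i + s)) v) = (d : k) • v := by
      rw [Finset.sum_sub_distrib, hv, sub_zero, Finset.sum_const, Finset.card_range,
        Nat.cast_smul_eq_nsmul]
    dsimp only
    rw [map_smul, ← smul_sub, map_sum, ← Finset.sum_sub_distrib,
      ← Finset.sum_congr rfl fun s _ => hw (i + s), hsum, smul_smul, inv_mul_cancel₀ hd', one_smul]

theorem stmt16 (k : Type*) [Field k] [CharZero k] (n : ℕ)
    (φ : MvPowerSeries (Fin n) k →ₐ[k] MvPowerSeries (Fin n) k)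
    (hlf : ∀ f : MvPowerSeries (Fin n) k,
      (Submodule.span k (Set.range fun m : ℕ => (φ ^ (m + 1)) f)).FG) :
    (∃ i j : ℕ, 1 ≤ i ∧ i < j ∧ φ ^ i = φ ^ j) ∧
    (∀ a : MvPowerSeries (Fin n) k,
      (∃ N : ℕ, ∀ m ≥ N, a ^ m ∈ Set.range (fun f : MvPowerSeries (Fin n) k => f - φ f)) →
      ∀ b : MvPowerSeries (Fin n) k, ∃ N : ℕ, ∀ m ≥ N,
        b * a ^ m ∈ Set.range (fun f : MvPowerSeries (Fin n) k => f - φ f)) := by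
  have hex : ∀ f, ∃ p : k[X], p ≠ 0 ∧ aeval φ.toLinearMap p f = 0 := fun f =>
    Module.End.exists_aeval_apply_eq_zero f
      (by simpa only [AlgHom.toLinearMap_pow_apply] using hlf f)
  obtain ⟨p, hp, hφ⟩ := MvPowerSeries.exists_aeval_toLinearMap_eq_zero φ hex
  have : IsDomain (MvPowerSeries (Fin n) k) := NoZeroDivisors.to_isDomain _
  obtain ⟨i, j, hi, hij, heq⟩ := φ.exists_pow_eq_pow_of_aeval_eq_zero hp hφ
  refine ⟨⟨i, j, hi, hij, heq⟩, ?_⟩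
  obtain ⟨d, rfl⟩ := Nat.exists_eq_add_of_lt hij
  have hT : φ.toLinearMap ^ i = φ.toLinearMap ^ (i + (d + 1)) := LinearMap.ext fun f => by
    rw [AlgHom.toLinearMap_pow_apply, AlgHom.toLinearMap_pow_apply, heq, add_assoc]
  have hmem : ∀ f, f ∈ Set.range (fun f : MvPowerSeries (Fin n) k => f - φ f) ↔
      ∑ s ∈ Finset.range (d + 1), (φ ^ (i + s)) f = 0 := fun f => by
    simpa only [AlgHom.toLinearMap_pow_apply, AlgHom.toLinearMap_apply] using
      Module.End.mem_range_sub_iff φ.toLinearMap d.succ_ne_zero hT f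
  rintro a ⟨N, hN⟩ b
  have : CharZero (MvPowerSeries (Fin n) k) := charZero_of_injective_algebraMap
    (algebraMap k (MvPowerSeries (Fin n) k)).injective
  have ha : ∀ s ∈ Finset.range (d + 1), (φ ^ (i + s)) a = 0 :=
    eq_zero_of_forall_sum_pow_eq_zero _ _ N fun m hm => by
      simpa only [map_pow] using (hmem _).1 (hN m hm)
  refine ⟨1, fun m hm => (hmem _).2 (Finset.sum_eq_zero fun s hs => ?_)⟩
  rw [map_mul, map_pow, ha s hs, zero_pow (by lia), mul_zero]
end

section
/- Let k be a field of characteristic zero and φ any k-algebra endomorphism of k[[x_1,…,x_n]][x^{−1}] (the localization of k[[x]] at the variables x_1,…,x_n). Then φ maps k[[x_1,…,x_n]] into itself. -/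
open MvPowerSeries in
theorem MvPowerSeries.exists_pow_eq_of_constantCoeff_eq_one {σ k : Type*} [Field k] [CharZero k]
    (f : MvPowerSeries σ k) (hf : constantCoeff f = 1) {N : ℕ} (hN : N ≠ 0) :
    ∃ h : MvPowerSeries σ k, h ^ N = f := by
  have hsubst : PowerSeries.HasSubst (f - 1) :=
    PowerSeries.HasSubst.of_constantCoeff_zero (by simp [hf])
  have hpow (m : ℕ) (r : ℚ) : PowerSeries.binomialSeries k ((m : ℚ) * r) =
      PowerSeries.binomialSeries k r ^ m := by
    induction m with
    | zero => simp
    | succ m ih => rw [Nat.cast_succ, add_mul, one_mul, PowerSeries.binomialSeries_add, ih, pow_succ]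
  have hroot : PowerSeries.binomialSeries k ((N : ℚ)⁻¹) ^ N = 1 + PowerSeries.X := by
    rw [← hpow, mul_inv_cancel₀ (by exact_mod_cast hN)]
    simpa using PowerSeries.binomialSeries_nat (R := ℚ) (A := k) 1
  refine ⟨PowerSeries.substAlgHom (R := k) hsubst (PowerSeries.binomialSeries k ((N : ℚ)⁻¹)), ?_⟩
  rw [← map_pow, hroot, map_add, map_one, PowerSeries.substAlgHom_X]
  ring

theorem MvPowerSeries.weightedOrder_pow {σ R : Type*} [CommSemiring R] [NoZeroDivisors R]
    [Nontrivial R] (w : σ → ℕ) (f : MvPowerSeries σ R) (n : ℕ) :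
    (f ^ n).weightedOrder w = n • f.weightedOrder w := by
  induction n with
  | zero => simp [weightedOrder_one]
  | succ n ih => rw [pow_succ, weightedOrder_mul, ih, succ_nsmul]

open MvPowerSeries in
theorem MvPowerSeries.monomial_one_dvd_of_le_weightedOrder {σ R : Type*} [DecidableEq σ]
    [CommSemiring R] {e : σ →₀ ℕ} {f : MvPowerSeries σ R}
    (h : ∀ i, (e i : ℕ∞) ≤ f.weightedOrder (Pi.single i 1)) :
    monomial e (1 : R) ∣ f := by
  let g : MvPowerSeries σ R := fun d => coeff (d + e) f
  refine ⟨g, ?_⟩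
  ext d
  rw [coeff_monomial_mul]
  split_ifs with hed
  · rw [one_mul]
    change _ = coeff (d - e + e) f
    rw [tsub_add_cancel_of_le hed]
  · obtain ⟨i, hi⟩ : ∃ i, d i < e i := by simpa [Finsupp.le_def] using hed
    apply coeff_eq_zero_of_lt_weightedOrder (Pi.single i 1)
    rw [Finsupp.weight_single_one_apply]
    exact lt_of_lt_of_le (by exact_mod_cast hi) (h i)

open MvPowerSeries in
theorem MvPowerSeries.exists_eq_monomial_of_mem_closure_range_X {σ R : Type*} [CommSemiring R]
    {s : MvPowerSeries σ R}
    (hs : s ∈ Submonoid.closure (Set.range (X : σ → MvPowerSeries σ R))) :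
    ∃ e : σ →₀ ℕ, s = monomial e 1 := by
  induction hs using Submonoid.closure_induction with
  | mem x hx =>
    obtain ⟨i, rfl⟩ := hx
    exact ⟨Finsupp.single i 1, rfl⟩
  | one => exact ⟨0, rfl⟩
  | mul x y _ _ hx hy =>
    obtain ⟨d, rfl⟩ := hx
    obtain ⟨e, rfl⟩ := hy
    exact ⟨d + e, by simp [monomial_mul_monomial]⟩

open MvPowerSeries in
/-- A Laurent-type series `a / s` having roots of all orders has no denominator. -/
theorem MvPowerSeries.exists_eq_algebraMap_of_forall_exists_pow_eq {σ k : Type*} [Field k]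
    (S : Submonoid (MvPowerSeries σ k))
    (hS : S = Submonoid.closure (Set.range (X : σ → MvPowerSeries σ k)))
    (u : Localization S) (hu : ∀ N : ℕ, N ≠ 0 → ∃ y, y ^ N = u) :
    ∃ g : MvPowerSeries σ k, u = algebraMap (MvPowerSeries σ k) (Localization S) g := by
  classical
  have hmon (s : S) : ∃ e : σ →₀ ℕ, (s : MvPowerSeries σ k) = monomial e 1 :=
    exists_eq_monomial_of_mem_closure_range_X (hS ▸ s.2)
  have hinj : Function.Injective (algebraMap (MvPowerSeries σ k) (Localization S)) := by
    refine IsLocalization.injective (M := S) _ fun s hs => mem_nonZeroDivisors_of_ne_zero ?_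
    obtain ⟨e, he⟩ := hmon ⟨s, hs⟩
    intro h0
    have := congrArg (coeff e) (he.symm.trans h0)
    simp at this
  obtain ⟨⟨a, s⟩, hs⟩ := IsLocalization.surj S u
  obtain ⟨e, he⟩ := hmon s
  have hdvd : monomial e (1 : k) ∣ a := by
    refine monomial_one_dvd_of_le_weightedOrder fun i => ?_
    obtain ⟨y, hy⟩ := hu (e i + 1) (Nat.succ_ne_zero _)
    obtain ⟨⟨b, t⟩, ht⟩ := IsLocalization.surj S y
    obtain ⟨d, hd⟩ := hmon t
    have key : b ^ (e i + 1) * s = a * t ^ (e i + 1) := by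
      apply hinj
      simp only [map_mul, map_pow]
      rw [← hs, ← ht, ← hy]
      ring
    rw [he, hd] at key
    by_cases ha : a = 0
    · simp [ha]
    have hb : b ≠ 0 := by
      rintro rfl
      have ht0 : monomial d (1 : k) ^ (e i + 1) ≠ 0 := pow_ne_zero _ fun h => by
        simpa using congrArg (coeff d) h
      refine mul_ne_zero ha ht0 ?_
      rw [← key, zero_pow (Nat.succ_ne_zero _), zero_mul]
    have hord := congrArg (weightedOrder (Pi.single i 1)) key
    simp only [weightedOrder_mul, weightedOrder_pow,
      weightedOrder_monomial_of_ne_zero _ (one_ne_zero (α := k)),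
      Finsupp.weight_single_one_apply] at hord
    rw [← (ne_zero_iff_weightedOrder_finite _).1 ha] at hord ⊢
    rw [← (ne_zero_iff_weightedOrder_finite _).1 hb] at hord
    generalize (weightedOrder (Pi.single i 1) a).toNat = A at hord ⊢
    generalize (weightedOrder (Pi.single i 1) b).toNat = B at hord
    have hnat : (e i + 1) * B + e i = A + (e i + 1) * d i := by
      simp only [nsmul_eq_mul] at hord
      exact_mod_cast hord
    norm_cast
    by_contra! hlt
    rcases le_or_gt (d i) B with h | h
    · nlinarith [Nat.mul_le_mul_left (e i + 1) h]
    · nlinarith [Nat.mul_le_mul_left (e i + 1) (Nat.succ_le_of_lt h)]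
  obtain ⟨g, rfl⟩ := hdvd
  refine ⟨g, (IsLocalization.map_units (Localization S) s).mul_right_cancel ?_⟩
  rw [hs, ← map_mul, he, mul_comm]

theorem stmt17 (k : Type*) [Field k] [CharZero k] (n : ℕ)
    (S : Submonoid (MvPowerSeries (Fin n) k))
    (hS : S = Submonoid.closure (Set.range (MvPowerSeries.X : Fin n → MvPowerSeries (Fin n) k)))
    (φ : Localization S →ₐ[k] Localization S) :
    ∀ f : MvPowerSeries (Fin n) k,
      ∃ g : MvPowerSeries (Fin n) k,
        φ (algebraMap (MvPowerSeries (Fin n) k) (Localization S) f) =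
          algebraMap (MvPowerSeries (Fin n) k) (Localization S) g := by
  intro f
  set c : k := 1 - MvPowerSeries.constantCoeff f with hc
  obtain ⟨g, hg⟩ := MvPowerSeries.exists_eq_algebraMap_of_forall_exists_pow_eq S hS
    (φ (algebraMap _ _ (f + algebraMap k _ c))) fun N hN => by
      obtain ⟨h, hh⟩ := MvPowerSeries.exists_pow_eq_of_constantCoeff_eq_one
        (f + algebraMap k _ c) (by simp [hc, MvPowerSeries.algebraMap_apply]) hN
      exact ⟨φ (algebraMap _ _ h), by rw [← map_pow, ← map_pow, hh]⟩
  refine ⟨g - algebraMap k _ c, ?_⟩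
  rw [map_sub, ← hg, map_add, map_add, ← IsScalarTower.algebraMap_apply, AlgHom.commutes,
    add_sub_cancel_right]
end

section
/- Let k be a field of characteristic zero. The algebra A = k[[x_1,…,x_n]][x^{−1}] has no nonzero locally finite k-derivation. -/
open TensorProduct

section LocallyFiniteDerivation

variable {K B : Type*} [Field K] [CommRing B] [Algebra K B]

/-- The shifted operators `D - a` and `D - b` satisfy a Leibniz rule with respect to
`D - (a + b)`. -/
theorem Derivation.sub_smul_one_mul (D : Derivation K B B) (a b : K) (u v : B) :
    ((D : Module.End K B) - (a + b) • (1 : Module.End K B)) (u * v) =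
      ((D : Module.End K B) - a • (1 : Module.End K B)) u * v +
        u * ((D : Module.End K B) - b • (1 : Module.End K B)) v := by
  simp only [LinearMap.sub_apply, LinearMap.smul_apply, Module.End.one_apply,
    Derivation.coeFn_coe, Derivation.leibniz, smul_eq_mul, add_smul, sub_mul, mul_sub, smul_mul_assoc,
    mul_smul_comm, LinearMap.add_apply]
  ring

/-- The top-order term of a product of two generalized eigenvectors of a derivation. -/
theorem Derivation.sub_smul_one_pow_mul (D : Derivation K B B) (a b : K) (m : ℕ) :
    ∀ (p q : ℕ) (u v : B), p + q = m →
      (((D : Module.End K B) - a • (1 : Module.End K B)) ^ (p + 1)) u = 0 →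
      (((D : Module.End K B) - b • (1 : Module.End K B)) ^ (q + 1)) v = 0 →
      (((D : Module.End K B) - (a + b) • (1 : Module.End K B)) ^ m) (u * v) =
        (m.choose p) • ((((D : Module.End K B) - a • (1 : Module.End K B)) ^ p) u *
          (((D : Module.End K B) - b • (1 : Module.End K B)) ^ q) v) := by
  induction m with
  | zero =>
    intro p q u v h hu hv
    obtain ⟨rfl, rfl⟩ : p = 0 ∧ q = 0 := by omega
    simp
  | succ m ih =>
    intro p q u v h hu hv
    rw [pow_succ, Module.End.mul_apply, D.sub_smul_one_mul, map_add]
    rcases p with _ | p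
    · obtain rfl : q = m + 1 := by omega
      rw [zero_add, pow_one] at hu
      rw [hu, ih 0 m u _ (by omega) (by simpa using hu)
        (by rwa [← Module.End.mul_apply, ← pow_succ])]
      simp [pow_succ]
    · rcases q with _ | q
      · obtain rfl : p = m := by omega
        rw [zero_add, pow_one] at hv
        rw [hv, ih p 0 _ v (by omega) (by rwa [← Module.End.mul_apply, ← pow_succ])
          (by simpa using hv)]
        simp [pow_succ]
      · rw [ih p (q + 1) _ v (by omega) (by rwa [← Module.End.mul_apply, ← pow_succ]) hv,
          ih (p + 1) q u _ (by omega) hu (by rwa [← Module.End.mul_apply, ← pow_succ]),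
          ← Module.End.mul_apply, ← Module.End.mul_apply, ← pow_succ, ← pow_succ, ← add_smul,
          Nat.choose_succ_succ]

theorem Derivation.mul_mem_maxGenEigenspace_s18 (D : Derivation K B B) {a b : K} {u v : B}
    (hu : u ∈ Module.End.maxGenEigenspace (D : Module.End K B) a)
    (hv : v ∈ Module.End.maxGenEigenspace (D : Module.End K B) b) :
    u * v ∈ Module.End.maxGenEigenspace (D : Module.End K B) (a + b) := by
  rw [Module.End.mem_maxGenEigenspace] at hu hv ⊢
  obtain ⟨p, hp⟩ := hu
  obtain ⟨q, hq⟩ := hv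
  refine ⟨(p + 1) + q, ?_⟩
  have hp' : (((D : Module.End K B) - a • (1 : Module.End K B)) ^ (p + 1)) u = 0 := by
    rw [pow_succ', Module.End.mul_apply, hp, map_zero]
  rw [D.sub_smul_one_pow_mul a b _ (p + 1) q u v rfl
    (by rw [pow_succ', Module.End.mul_apply, hp', map_zero])
    (by rw [pow_succ', Module.End.mul_apply, hq, map_zero]), hp']
  simp

theorem Derivation.one_mem_maxGenEigenspace (D : Derivation K B B) :
    (1 : B) ∈ Module.End.maxGenEigenspace (D : Module.End K B) 0 := by
  rw [Module.End.mem_maxGenEigenspace]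
  exact ⟨1, by simp⟩

/-- A generalized eigenvector of a derivation that is a unit with generalized eigenvector inverse
is an eigenvector. -/
theorem Derivation.eq_smul_of_mem_maxGenEigenspace [CharZero K] [IsDomain B]
    (D : Derivation K B B) {a b : K} {u v : B} (huv : u * v = 1)
    (hu : u ∈ Module.End.maxGenEigenspace (D : Module.End K B) a)
    (hv : v ∈ Module.End.maxGenEigenspace (D : Module.End K B) b) (hab : a + b = 0) :
    D u = a • u := by
  classical
  rw [Module.End.mem_maxGenEigenspace] at hu hv
  have hu0 : u ≠ 0 := left_ne_zero_of_mul_eq_one huv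
  have hv0 : v ≠ 0 := right_ne_zero_of_mul_eq_one huv
  have exists_last : ∀ (T : Module.End K B) (w : B), w ≠ 0 → (∃ m, (T ^ m) w = 0) →
      ∃ p, (T ^ p) w ≠ 0 ∧ (T ^ (p + 1)) w = 0 := by
    intro T w hw h
    have hpos : Nat.find h ≠ 0 := fun h0 ↦ hw (by simpa [h0] using Nat.find_spec h)
    obtain ⟨p, hp⟩ := Nat.exists_eq_succ_of_ne_zero hpos
    exact ⟨p, Nat.find_min h (by omega), by simpa [hp] using Nat.find_spec h⟩
  obtain ⟨p, hp, hp'⟩ := exists_last _ u hu0 hu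
  obtain ⟨q, hq, hq'⟩ := exists_last _ v hv0 hv
  have key := D.sub_smul_one_pow_mul a b (p + q) p q u v rfl hp' hq'
  have : CharZero B := charZero_of_injective_algebraMap (algebraMap K B).injective
  rcases p with _ | p
  · simpa [sub_eq_zero] using hp'
  · exfalso
    rw [huv, hab, zero_smul, sub_zero, show p + 1 + q = (p + q) + 1 by omega, pow_succ,
      Module.End.mul_apply, Derivation.coeFn_coe, D.map_one_eq_zero, map_zero] at key
    exact smul_ne_zero (Nat.choose_pos (by omega)).ne' (mul_ne_zero hp hq) key.symm

/-- If `B` is the sum of the generalized eigenspaces of a derivation, every unit of `B` is an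
eigenvector. -/
theorem Derivation.exists_eq_smul_of_isUnit [CharZero K] [IsDomain B] (D : Derivation K B B)
    (hD : ⨆ a, Module.End.maxGenEigenspace (D : Module.End K B) a = ⊤) {u : B} (hu : IsUnit u) :
    ∃ a : K, D u = a • u := by
  classical
  let W : K → Submodule K B := Module.End.maxGenEigenspace (D : Module.End K B)
  have hW : DirectSum.IsInternal W :=
    DirectSum.isInternal_submodule_of_iSupIndep_of_iSup_eq_top
      (Module.End.independent_maxGenEigenspace _) hD
  let : DirectSum.Decomposition W := hW.chooseDecomposition
  have : SetLike.GradedMonoid W :=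
    { one_mem := D.one_mem_maxGenEigenspace
      mul_mem := fun _ _ _ _ h h' ↦ D.mul_mem_maxGenEigenspace_s18 h h' }
  let : GradedRing W := { }
  let : Module ℚ K := Algebra.toModule
  obtain ⟨v, huv⟩ := hu.exists_right_inv
  set s := (DirectSum.decompose W u).support
  set t := (DirectSum.decompose W v).support
  have unique_sum : ∀ a ∈ s, ∀ b ∈ t, UniqueAdd s t a b → a + b = 0 := by
    intro a ha b hb hab
    by_contra hne
    have h1 : ((DirectSum.decompose W (u * v)) (a + b) : B) = 0 := by
      rw [huv]
      exact DirectSum.decompose_of_mem_ne W D.one_mem_maxGenEigenspace (Ne.symm hne)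
    rw [DirectSum.decompose_mul, DirectSum.coe_mul_apply, Finset.sum_eq_single (a, b)] at h1
    · rw [DFinsupp.mem_support_toFun] at ha hb
      rcases mul_eq_zero.mp h1 with h | h
      · exact ha (Subtype.ext h)
      · exact hb (Subtype.ext h)
    · rintro ⟨c, d⟩ hcd hcd'
      simp only [Finset.mem_filter, Finset.mem_product] at hcd
      obtain ⟨rfl, rfl⟩ := hab hcd.1.1 hcd.1.2 hcd.2
      exact absurd rfl hcd'
    · intro h
      exact (h (Finset.mem_filter.mpr ⟨Finset.mem_product.mpr ⟨ha, hb⟩, rfl⟩)).elim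
  have nonempty : ∀ w : B, w ≠ 0 → (DirectSum.decompose W w).support.Nonempty := by
    intro w hw
    rw [Finset.nonempty_iff_ne_empty, Ne, DFinsupp.support_eq_empty]
    exact fun h ↦ hw ((DirectSum.decompose W).injective (h.trans (DirectSum.decompose_zero W).symm))
  have hsne := nonempty u (left_ne_zero_of_mul_eq_one huv)
  have htne := nonempty v (right_ne_zero_of_mul_eq_one huv)
  have hcard : s.card * t.card ≤ 1 := by
    by_contra! h
    obtain ⟨p, hp, q, hq, hpq, hup, huq⟩ := TwoUniqueSums.uniqueAdd_of_one_lt_card h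
    rw [Finset.mem_product] at hp hq
    have h1 := unique_sum _ hp.1 _ hp.2 hup
    have h2 := unique_sum _ hq.1 _ hq.2 huq
    obtain ⟨h3, h4⟩ := hup hq.1 hq.2 (h2.trans h1.symm)
    exact hpq (Prod.ext h3.symm h4.symm)
  have hspos := hsne.card_pos
  have htpos := htne.card_pos
  obtain ⟨a, ha⟩ := Finset.card_eq_one.mp (show s.card = 1 by nlinarith)
  obtain ⟨b, hb⟩ := Finset.card_eq_one.mp (show t.card = 1 by nlinarith)
  have mem_of_support : ∀ (w : B) (c : K), (DirectSum.decompose W w).support = {c} → w ∈ W c := by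
    intro w c h
    rw [← DirectSum.sum_support_decompose W w, h, Finset.sum_singleton]
    exact Subtype.property _
  exact ⟨a, D.eq_smul_of_mem_maxGenEigenspace huv (mem_of_support u a ha) (mem_of_support v b hb)
    (unique_sum a (by simp [ha]) b (by simp [hb]) (by
      intro c d hc hd _
      simpa [ha, hb] using And.intro hc hd))⟩

/-- If both `1 + f` and `1 + 2 f` are eigenvectors of a derivation, then `f` is a constant. -/
theorem Derivation.eq_zero_of_eigenvector_one_add [CharZero K] [IsDomain B] (D : Derivation K B B)
    {f : B} {a b : K} (ha : D (1 + f) = a • (1 + f)) (hb : D (1 + 2 * f) = b • (1 + 2 * f)) :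
    D f = 0 := by
  have h2 : D (2 * f) = 2 * D f := by rw [two_mul, map_add, two_mul]
  rw [map_add, D.map_one_eq_zero, zero_add] at ha hb
  rw [h2] at hb
  have : CharZero B := charZero_of_injective_algebraMap (algebraMap K B).injective
  have hDa : D (D f) = a • D f := by
    conv_lhs => rw [ha]
    rw [D.map_smul, map_add, D.map_one_eq_zero, zero_add]
  have hDb : 2 * D (D f) = 2 * b • D f := by
    have h := congrArg D hb
    rw [two_mul, map_add, ← two_mul, D.map_smul, map_add, D.map_one_eq_zero, zero_add, h2] at h
    rw [h, mul_smul_comm]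
  have hab : (a - b) • D f = 0 := by
    rw [sub_smul, sub_eq_zero, ← hDa]
    exact mul_left_cancel₀ two_ne_zero hDb
  rcases smul_eq_zero.mp hab with h | h
  · rw [← sub_eq_zero.mp h] at hb
    have h0 : a • (1 : B) = 0 := by
      rw [ha] at hb
      simp only [Algebra.smul_def] at hb ⊢
      linear_combination hb
    have : a = 0 := by simpa using h0
    rw [ha, this, zero_smul]
  · exact h

end LocallyFiniteDerivation

theorem Module.End.mem_iSup_maxGenEigenspace {K V : Type*} [Field K] [IsAlgClosed K]
    [AddCommGroup V] [Module K V] (T : Module.End K V) {W : Submodule K V} (hW : W.FG)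
    (hTW : ∀ w ∈ W, T w ∈ W) {w : V} (hw : w ∈ W) : w ∈ ⨆ a, T.maxGenEigenspace a := by
  have : FiniteDimensional K W := Module.Finite.iff_fg.mpr hW
  have htop := Module.End.iSup_maxGenEigenspace_eq_top (T.restrict hTW)
  have hmem : (⟨w, hw⟩ : W) ∈ ⨆ a, Module.End.maxGenEigenspace (T.restrict hTW) a := htop ▸ Submodule.mem_top
  have hmap := Submodule.mem_map_of_mem (f := W.subtype) hmem
  rw [Submodule.map_iSup] at hmap
  suffices h : ∀ a, (Module.End.maxGenEigenspace (T.restrict hTW) a).map W.subtype ≤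
      T.maxGenEigenspace a from iSup_mono h hmap
  intro a
  rw [Module.End.maxGenEigenspace, Module.End.genEigenspace_restrict]
  exact Submodule.map_comap_le _ _

section BaseChange

variable {k A : Type*} (K : Type*) [Field k] [Field K] [Algebra k K] [CommRing A] [Algebra k A]

/-- The extension of scalars of a derivation. -/
noncomputable def Derivation.tensorExtend (D : Derivation k A A) :
    Derivation K (K ⊗[k] A) (K ⊗[k] A) :=
  Derivation.mk' ((D : A →ₗ[k] A).baseChange K) fun x y ↦ by
    induction x with
    | zero => simp
    | add x x' hx hx' => simp only [add_mul, map_add, hx, hx', add_smul, smul_add]; abel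
    | tmul c a =>
      induction y with
      | zero => simp
      | add y y' hy hy' => simp only [mul_add, map_add, hy, hy', add_smul, smul_add]; abel
      | tmul d b =>
        simp [TensorProduct.tmul_add, mul_comm d c]

theorem Derivation.iSup_maxGenEigenspace_tensorExtend [IsAlgClosed K] (D : Derivation k A A)
    (hlf : ∀ a : A, (Submodule.span k (Set.range fun m : ℕ => (⇑D)^[m] a)).FG) :
    ⨆ a, Module.End.maxGenEigenspace (D.tensorExtend K : Module.End K (K ⊗[k] A)) a = ⊤ := by
  rw [eq_top_iff]
  rintro x -
  induction x with
  | zero => exact zero_mem _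
  | add x y hx hy => exact add_mem hx hy
  | tmul c a =>
    set V := Submodule.span k (Set.range fun m : ℕ => (⇑D)^[m] a) with hV
    have hDV : ∀ w ∈ V, D w ∈ V := by
      intro w hw
      induction hw using Submodule.span_induction with
      | mem w hw =>
        obtain ⟨m, rfl⟩ := hw
        exact Submodule.subset_span ⟨m + 1, Function.iterate_succ_apply' _ _ _⟩
      | zero => simp
      | add w w' _ _ hw hw' => rw [map_add]; exact add_mem hw hw'
      | smul r w _ hw => rw [D.map_smul]; exact V.smul_mem r hw
    refine Module.End.mem_iSup_maxGenEigenspace _ (W := V.baseChange K) ?_ ?_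
      (Submodule.tmul_mem_baseChange_of_mem c (Submodule.subset_span ⟨0, rfl⟩))
    · obtain ⟨s, hs⟩ := hlf a
      rw [← hV] at hs
      classical
      rw [← hs, Submodule.baseChange_span]
      exact ⟨s.image (TensorProduct.mk k K A 1), by simp⟩
    · intro w hw
      rw [Submodule.baseChange_eq_span] at hw
      induction hw using Submodule.span_induction with
      | mem w hw =>
        obtain ⟨v, hv, rfl⟩ := hw
        exact Submodule.tmul_mem_baseChange_of_mem 1 (hDV v hv)
      | zero => simp
      | add w w' _ _ hw hw' => rw [map_add]; exact add_mem hw hw'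
      | smul r w _ hw => rw [LinearMap.map_smul]; exact Submodule.smul_mem _ r hw

/-- A locally finite derivation kills every `f` for which `1 + f` and `1 + 2 f` are units, as long
as the algebra stays a domain over the algebraic closure. -/
theorem Derivation.eq_zero_of_isUnit_one_add [CharZero k] [IsDomain (AlgebraicClosure k ⊗[k] A)]
    (D : Derivation k A A)
    (hlf : ∀ a : A, (Submodule.span k (Set.range fun m : ℕ => (⇑D)^[m] a)).FG) {f : A}
    (h1 : IsUnit (1 + f)) (h2 : IsUnit (1 + 2 * f)) : D f = 0 := by
  let K := AlgebraicClosure k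
  have : CharZero K := charZero_of_injective_algebraMap (algebraMap k K).injective
  have htop := D.iSup_maxGenEigenspace_tensorExtend K hlf
  let i : A →ₐ[k] K ⊗[k] A := Algebra.TensorProduct.includeRight
  obtain ⟨a, ha⟩ := (D.tensorExtend K).exists_eq_smul_of_isUnit htop (h1.map i)
  obtain ⟨b, hb⟩ := (D.tensorExtend K).exists_eq_smul_of_isUnit htop (h2.map i)
  rw [map_add, map_one] at ha
  rw [map_add, map_mul, map_one, map_ofNat] at hb
  have h := (D.tensorExtend K).eq_zero_of_eigenvector_one_add ha hb
  have hinj : Function.Injective i :=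
    Algebra.TensorProduct.includeRight_injective (algebraMap k K).injective
  exact hinj (h.trans (map_zero i).symm)

theorem MvPowerSeries.isDomain_tensorProduct (σ : Type*) :
    IsDomain (K ⊗[k] MvPowerSeries σ k) := by
  let φ : K ⊗[k] MvPowerSeries σ k →ₐ[K] MvPowerSeries σ K :=
    Algebra.TensorProduct.lift (Algebra.ofId K _) (MvPowerSeries.mapAlgHom (Algebra.ofId k K))
      fun _ _ ↦ Commute.all _ _
  have hinj : Function.Injective φ := by
    classical
    rw [injective_iff_map_eq_zero]
    intro x hx
    let b := Module.Basis.ofVectorSpace k K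
    let e := TensorProduct.equivFinsuppOfBasisLeft (N := MvPowerSeries σ k) b
    obtain ⟨g, rfl⟩ := e.symm.surjective x
    suffices g = 0 by rw [this, map_zero]
    rw [TensorProduct.equivFinsuppOfBasisLeft_symm_apply, Finsupp.sum, map_sum] at hx
    ext i d
    have hd : ∑ i ∈ g.support, MvPowerSeries.coeff d (g i) • b i = 0 := by
      rw [← map_zero (MvPowerSeries.coeff (R := K) d), ← hx, map_sum]
      refine Finset.sum_congr rfl fun i _ ↦ ?_
      rw [Algebra.TensorProduct.lift_tmul, Algebra.ofId_apply, ← Algebra.smul_def,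
        MvPowerSeries.coeff_smul, Algebra.smul_def, mul_comm]
      rfl
    by_cases hi : i ∈ g.support
    · simpa using linearIndependent_iff'.mp b.linearIndependent _ _ hd i hi
    · simp [Finsupp.notMem_support_iff.mp hi]
  have : IsDomain (MvPowerSeries σ K) := NoZeroDivisors.to_isDomain _
  exact hinj.isDomain φ.toRingHom

/-- Localization preserves the property of being a domain after extension of scalars. -/
theorem IsLocalization.isDomain_tensorProduct {R : Type*} [CommRing R] [Algebra k R] [Algebra R A]
    [IsScalarTower k R A] [IsDomain (K ⊗[k] R)] (S : Submonoid R) [IsLocalization S A]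
    (hS : Function.Injective (algebraMap R A)) : IsDomain (K ⊗[k] A) := by
  let j : K ⊗[k] R →ₐ[K] K ⊗[k] A :=
    Algebra.TensorProduct.map (AlgHom.id K K) (IsScalarTower.toAlgHom k R A)
  have hj : Function.Injective j :=
    Module.Flat.lTensor_preserves_injective_linearMap (M := K)
      (IsScalarTower.toAlgHom k R A).toLinearMap hS
  have hunit : ∀ s : S, IsUnit (j (1 ⊗ₜ (s : R))) := fun s ↦
    (IsLocalization.map_units A s).map (Algebra.TensorProduct.includeRight : A →ₐ[k] K ⊗[k] A)
  have exists_mul : ∀ x : K ⊗[k] A, ∃ (s : S) (r : K ⊗[k] R), x * j (1 ⊗ₜ (s : R)) = j r := by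
    intro x
    induction x with
    | zero => exact ⟨1, 0, by simp⟩
    | tmul c a =>
      obtain ⟨⟨r, s⟩, h⟩ := IsLocalization.surj S a
      exact ⟨s, c ⊗ₜ r, by simpa [j] using congrArg (c ⊗ₜ[k] ·) h⟩
    | add x y hx hy =>
      obtain ⟨s, r, h⟩ := hx
      obtain ⟨t, q, h'⟩ := hy
      refine ⟨s * t, r * 1 ⊗ₜ (t : R) + q * 1 ⊗ₜ (s : R), ?_⟩
      have hst : (1 : K) ⊗ₜ[k] ((s * t : S) : R) = 1 ⊗ₜ (s : R) * 1 ⊗ₜ (t : R) := by simp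
      rw [hst, map_mul, map_add, map_mul, map_mul, ← h, ← h']
      ring
  have : Nontrivial (K ⊗[k] A) := hj.nontrivial
  have : NoZeroDivisors (K ⊗[k] A) := by
    refine ⟨fun {x y} hxy ↦ ?_⟩
    obtain ⟨s, r, h⟩ := exists_mul x
    obtain ⟨t, q, h'⟩ := exists_mul y
    have hrq : r * q = 0 := by
      apply hj
      rw [map_mul, ← h, ← h', map_zero]
      linear_combination (j (1 ⊗ₜ (s : R)) * j (1 ⊗ₜ (t : R))) * hxy
    rcases mul_eq_zero.mp hrq with h0 | h0
    · left
      rwa [h0, map_zero, (hunit s).mul_left_eq_zero] at h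
    · right
      rwa [h0, map_zero, (hunit t).mul_left_eq_zero] at h'
  exact NoZeroDivisors.to_isDomain _

end BaseChange

theorem stmt18 (k : Type*) [Field k] [CharZero k] (n : ℕ)
    (S : Submonoid (MvPowerSeries (Fin n) k))
    (hS : S = Submonoid.closure (Set.range (MvPowerSeries.X : Fin n → MvPowerSeries (Fin n) k)))
    (D : Derivation k (Localization S) (Localization S))
    (hlf : ∀ a : Localization S,
      (Submodule.span k (Set.range fun m : ℕ => (⇑D)^[m] a)).FG) :
    D = 0 := by
  have hS0 : S ≤ nonZeroDivisors (MvPowerSeries (Fin n) k) := by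
    rw [hS, Submonoid.closure_le]
    rintro _ ⟨i, rfl⟩
    exact MvPowerSeries.X_mem_nonzeroDivisors
  have := MvPowerSeries.isDomain_tensorProduct (k := k) (AlgebraicClosure k) (Fin n)
  have := IsLocalization.isDomain_tensorProduct (k := k) (A := Localization S) (AlgebraicClosure k)
    S (IsLocalization.injective _ hS0)
  have isUnit_one_add : ∀ f : MvPowerSeries (Fin n) k, MvPowerSeries.constantCoeff f = 0 →
      IsUnit (1 + algebraMap _ (Localization S) f) := by
    intro f hf
    rw [← map_one (algebraMap (MvPowerSeries (Fin n) k) (Localization S)), ← map_add]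
    exact IsUnit.map _ (MvPowerSeries.isUnit_iff_constantCoeff.mpr (by simp [hf]))
  have hD : ∀ f : MvPowerSeries (Fin n) k, D (algebraMap _ _ f) = 0 := by
    intro f
    let c := MvPowerSeries.constantCoeff f
    have hf : f = algebraMap k _ c + (f - algebraMap k _ c) := by ring
    have h0 : MvPowerSeries.constantCoeff (f - algebraMap k _ c) = 0 := by
      simp [c, MvPowerSeries.algebraMap_apply]
    rw [hf, map_add, map_add, ← IsScalarTower.algebraMap_apply, D.map_algebraMap, zero_add]
    refine D.eq_zero_of_isUnit_one_add hlf (isUnit_one_add _ h0) ?_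
    rw [← map_ofNat (algebraMap (MvPowerSeries (Fin n) k) (Localization S)) 2, ← map_mul]
    exact isUnit_one_add _ (by rw [map_mul, h0, mul_zero])
  ext a
  obtain ⟨⟨r, s⟩, h⟩ := IsLocalization.surj S a
  have h' := congrArg D h
  rw [D.leibniz, hD, hD, smul_zero, zero_add, smul_eq_mul] at h'
  exact (IsLocalization.map_units (Localization S) s).mul_right_eq_zero.mp h'
end
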